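/- arXiv:2006.00167 — 14 statements merged into one kernel-verified Lean document; each statement's English description precedes it below -/
import Mathlib

section
/- Let p, q, r be primes congruent to 7 modulo 8 such that p is a quadratic residue modulo q and modulo r, and q is a quadratic residue modulo r. Let f(x,y) = a·x² + b·x·y + c·y² be a positive definite integral binary quadratic form of discriminant b² − 4ac = −p·q·r such that a is a nonzero square modulo q and a quadratic nonresidue modulo p and modulo r. Then f does not represent any unit of ℤ[1/(2pqr)] times a nonzero square: equivalently, for every sign ε ∈ {1, −1} and every positive squarefree integer s dividing 2·p·q·r, there do not exist rational numbers x, y, z, not all zero, with a·x² + b·x·y + c·y² = ε·s·z². -/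
theorem eq_zero_of_sq_mul_eq_of_not_isSquare_mul {F : Type*} [Field F] {A B x z : F}
    (h : ¬ IsSquare (A * B)) (e : A * x ^ 2 = B * z ^ 2) : x = 0 ∧ z = 0 := by
  have hA : A ≠ 0 := by rintro rfl; simp at h
  have hz : z = 0 := by
    by_contra hz
    refine h ⟨A * x / z, ?_⟩
    field_simp
    linear_combination -e
  subst hz
  simpa [hA] using e

section TernaryForm

variable {r : ℕ} [Fact r.Prime] {A B C : ℤ}

theorem dvd_of_ternary_eq (h : ¬ IsSquare ((A * B : ℤ) : ZMod r)) (hC : ¬ (r : ℤ) ∣ C)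
    {x y z : ℤ} (e : A * x ^ 2 = B * z ^ 2 + r * C * y ^ 2) :
    (r : ℤ) ∣ x ∧ (r : ℤ) ∣ y ∧ (r : ℤ) ∣ z := by
  have hr : Prime (r : ℤ) := Nat.prime_iff_prime_int.mp Fact.out
  have e' : (A : ZMod r) * (x : ZMod r) ^ 2 = B * (z : ZMod r) ^ 2 := by
    simpa using congrArg (Int.cast : ℤ → ZMod r) e
  obtain ⟨hx, hz⟩ := eq_zero_of_sq_mul_eq_of_not_isSquare_mul (by simpa using h) e'
  rw [ZMod.intCast_zmod_eq_zero_iff_dvd] at hx hz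
  refine ⟨hx, ?_, hz⟩
  obtain ⟨x, rfl⟩ := hx
  obtain ⟨z, rfl⟩ := hz
  have hd : (r : ℤ) ∣ C * y ^ 2 :=
    ⟨A * x ^ 2 - B * z ^ 2, mul_left_cancel₀ hr.ne_zero (by linear_combination -e)⟩
  exact hr.dvd_of_dvd_pow ((hr.dvd_or_dvd hd).resolve_left hC)

theorem pow_dvd_of_ternary_eq (h : ¬ IsSquare ((A * B : ℤ) : ZMod r)) (hC : ¬ (r : ℤ) ∣ C)
    (n : ℕ) {x y z : ℤ} (e : A * x ^ 2 = B * z ^ 2 + r * C * y ^ 2) :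
    (r : ℤ) ^ n ∣ x ∧ (r : ℤ) ^ n ∣ y ∧ (r : ℤ) ^ n ∣ z := by
  induction n generalizing x y z with
  | zero => simp
  | succ n ih =>
    have hr : (r : ℤ) ≠ 0 := mod_cast (Fact.out : r.Prime).ne_zero
    obtain ⟨⟨x, rfl⟩, ⟨y, rfl⟩, ⟨z, rfl⟩⟩ := dvd_of_ternary_eq h hC e
    obtain ⟨hx, hy, hz⟩ := ih (x := x) (y := y) (z := z)
      (mul_left_cancel₀ (pow_ne_zero 2 hr) (by linear_combination e))
    simp only [pow_succ']
    exact ⟨mul_dvd_mul_left _ hx, mul_dvd_mul_left _ hy, mul_dvd_mul_left _ hz⟩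

theorem eq_zero_of_ternary_eq_int (h : ¬ IsSquare ((A * B : ℤ) : ZMod r))
    (hC : ¬ (r : ℤ) ∣ C) {x y z : ℤ} (e : A * x ^ 2 = B * z ^ 2 + r * C * y ^ 2) :
    x = 0 ∧ y = 0 ∧ z = 0 := by
  have key (t : ℤ) (ht : ∀ n : ℕ, (r : ℤ) ^ n ∣ t) : t = 0 := by
    refine Int.eq_zero_of_abs_lt_dvd (ht t.natAbs) ?_
    rw [Int.abs_eq_natAbs]
    exact_mod_cast Nat.lt_pow_self (Fact.out : r.Prime).one_lt
  exact ⟨key x fun n ↦ (pow_dvd_of_ternary_eq h hC n e).1,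
    key y fun n ↦ (pow_dvd_of_ternary_eq h hC n e).2.1,
    key z fun n ↦ (pow_dvd_of_ternary_eq h hC n e).2.2⟩

theorem eq_zero_of_ternary_eq (h : ¬ IsSquare ((A * B : ℤ) : ZMod r))
    (hC : ¬ (r : ℤ) ∣ C) {x y z : ℚ} (e : A * x ^ 2 = B * z ^ 2 + r * C * y ^ 2) :
    x = 0 ∧ y = 0 ∧ z = 0 := by
  have hx := x.den_ne_zero
  have hy := y.den_ne_zero
  have hz := z.den_ne_zero
  have e' : A * (x.num * y.den * z.den) ^ 2 =
      B * (z.num * x.den * y.den) ^ 2 + r * C * (y.num * x.den * z.den) ^ 2 := by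
    rw [← Rat.num_div_den x, ← Rat.num_div_den y, ← Rat.num_div_den z] at e
    field_simp at e
    qify
    linear_combination e
  simpa [hx, hy, hz] using eq_zero_of_ternary_eq_int h hC e'

end TernaryForm

theorem isSquare_natCast_of_forall_prime {R : Type*} [CommSemiring R] {d : ℕ} (hd : d ≠ 0)
    (h : ∀ l : ℕ, l.Prime → l ∣ d → IsSquare (l : R)) : IsSquare (d : R) := by
  induction d using Nat.recOnMul with
  | zero => exact absurd rfl hd
  | one => simp
  | prime l hl => exact h l hl dvd_rfl
  | mul m n hm hn =>
    rw [mul_ne_zero_iff] at hd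
    rw [Nat.cast_mul]
    exact (hm hd.1 fun l hl hlm ↦ h l hl (hlm.mul_right n)).mul
      (hn hd.2 fun l hl hln ↦ h l hl (hln.mul_left m))

theorem IsSquare.not_isSquare_mul {F : Type*} [Field F] {u v : F} (hu : IsSquare u) (hu0 : u ≠ 0)
    (hv : ¬ IsSquare v) : ¬ IsSquare (u * v) := fun h ↦
  hv (by simpa [hu0] using h.div hu)

theorem stmt0 (p q r : ℕ) [Fact p.Prime] [Fact q.Prime] [Fact r.Prime]
    (hp7 : p % 8 = 7) (hq7 : q % 8 = 7) (hr7 : r % 8 = 7)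
    (hpq : IsSquare ((p : ZMod q))) (hpr : IsSquare ((p : ZMod r)))
    (hqr : IsSquare ((q : ZMod r)))
    (a b c : ℤ) (hpos : 0 < a) (hdisc : b ^ 2 - 4 * a * c = -((p : ℤ) * q * r))
    (haq : IsSquare ((a : ZMod q))) (haq0 : (a : ZMod q) ≠ 0)
    (hap : ¬ IsSquare ((a : ZMod p))) (har : ¬ IsSquare ((a : ZMod r))) :
    ∀ ε : ℤ, (ε = 1 ∨ ε = -1) →
    ∀ s : ℕ, 0 < s → Squarefree s → s ∣ 2 * p * q * r →
    ¬ ∃ x y z : ℚ, ¬ (x = 0 ∧ y = 0 ∧ z = 0) ∧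
      (a : ℚ) * x ^ 2 + (b : ℚ) * x * y + (c : ℚ) * y ^ 2 = (ε : ℚ) * (s : ℚ) * z ^ 2 := by
  rintro ε hε s hs hsf hdvd ⟨x, y, z, hne, e⟩
  have hp : p.Prime := Fact.out
  have hq : q.Prime := Fact.out
  have hr : r.Prime := Fact.out
  have hqr' : q ≠ r := by rintro rfl; exact har haq
  have hpq' : p ≠ q := by rintro rfl; exact hap haq
  have hpr' : p ≠ r := by
    rintro rfl
    exact (ZMod.exists_sq_eq_prime_iff_of_mod_four_eq_three (p := p) (q := q) (by lia) (by lia)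
      hpq').mp hqr hpq
  have ha : (a : ℚ) ≠ 0 := mod_cast hpos.ne'
  have hD : (b : ℚ) ^ 2 - 4 * a * c = -(p * q * r) := mod_cast hdisc
  -- completing the square
  have e₁ : (2 * a * x + b * y) ^ 2 + p * q * r * y ^ 2 = a * ε * s * (2 * z) ^ 2 := by
    linear_combination 4 * a * e + y ^ 2 * hD
  have hnt : ¬ (2 * a * x + b * y = 0 ∧ y = 0 ∧ 2 * z = 0) := by
    rintro ⟨h₁, rfl, h₃⟩
    simp_all
  generalize 2 * a * x + b * y = X at e₁ hnt
  generalize 2 * z = Z at e₁ hnt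
  have hpqr : (0 : ℚ) < p * q * r := mod_cast Nat.mul_pos (Nat.mul_pos hp.pos hq.pos) hr.pos
  rcases hε with rfl | rfl
  swap
  · have has : (0 : ℚ) < a * s := mul_pos (mod_cast hpos) (mod_cast hs)
    have h₁ := sq_nonneg X
    have h₂ := mul_nonneg hpqr.le (sq_nonneg y)
    have h₃ := mul_nonneg has.le (sq_nonneg Z)
    push_cast at e₁
    have hX : X ^ 2 = 0 := by linarith
    have hY : p * q * r * y ^ 2 = 0 := by linarith
    have hZ : a * s * Z ^ 2 = 0 := by linarith
    exact hnt ⟨by simpa using hX, by simpa [hpqr.ne'] using hY, by simpa [has.ne'] using hZ⟩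
  have h2 : IsSquare (2 : ZMod r) := (ZMod.exists_sq_eq_two_iff (by lia)).mpr (Or.inr hr7)
  have hsq {d : ℕ} (hd : d ∣ 2 * p * q * r) (hrd : ¬ r ∣ d) : IsSquare (d : ZMod r) := by
    have hd0 : d ≠ 0 := by rintro rfl; simp at hrd
    refine isSquare_natCast_of_forall_prime hd0 fun l hl hld ↦ ?_
    have hl' := hld.trans hd
    simp only [hl.dvd_mul, Nat.prime_dvd_prime_iff_eq hl, hp, hq, hr, Nat.prime_two] at hl'
    rcases hl' with ((rfl | rfl) | rfl) | rfl
    · exact_mod_cast h2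
    · exact hpr
    · exact hqr
    · exact absurd hld hrd
  have hnsq {d : ℕ} (hd : IsSquare (d : ZMod r)) (hrd : ¬ r ∣ d) :
      ¬ IsSquare ((d : ZMod r) * a) :=
    hd.not_isSquare_mul (by rwa [Ne, ZMod.natCast_eq_zero_iff]) har
  have hrpq : ¬ r ∣ p * q := by
    rw [hr.dvd_mul, Nat.prime_dvd_prime_iff_eq hr hp, Nat.prime_dvd_prime_iff_eq hr hq]
    tauto
  by_cases hrs : r ∣ s
  · obtain ⟨d, rfl⟩ := hrs
    have hrd : ¬ r ∣ d := fun h ↦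
      hr.one_lt.ne' (Nat.isUnit_iff.mp (hsf r (mul_dvd_mul_left r h)))
    have hrpqd : ¬ r ∣ p * q * d := by rw [hr.dvd_mul]; tauto
    have hsq' : IsSquare ((p * q * d : ℕ) : ZMod r) := by
      push_cast
      exact (hpr.mul hqr).mul (hsq ((dvd_mul_left d r).trans hdvd) hrd)
    have hr0 : (r : ℚ) ≠ 0 := mod_cast hr.ne_zero
    obtain ⟨hy, hX, hZ⟩ := eq_zero_of_ternary_eq (r := r) (A := p * q) (B := a * d) (C := -1)
      (x := y) (y := X / r) (z := Z)
      (by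
        convert hnsq hsq' hrpqd using 2
        push_cast
        ring)
      (by simpa [Int.natCast_dvd] using hr.one_lt.ne')
      (by
        push_cast at e₁ ⊢
        field_simp
        linear_combination e₁)
    exact hnt ⟨by simpa [hr0] using hX, hy, hZ⟩
  · obtain ⟨hX, hy, hZ⟩ := eq_zero_of_ternary_eq (r := r) (A := 1) (B := a * s) (C := -(p * q))
      (x := X) (y := y) (z := Z)
      (by
        convert hnsq (hsq hdvd hrs) hrs using 2
        push_cast
        ring)
      (by rw [dvd_neg]; exact_mod_cast hrpq)
      (by
        push_cast at e₁ ⊢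
        linear_combination e₁)
    exact hnt ⟨hX, hy, hZ⟩
end

section
/- Let p, q, r be primes congruent to 7 modulo 8 such that p is a quadratic residue modulo q and modulo r, and q is a quadratic residue modulo r. Let f(x,y) = a·x² + b·x·y + c·y² be a positive definite integral binary quadratic form of discriminant b² − 4ac = −p·q·r such that a is a nonzero square modulo q and a quadratic nonresidue modulo p and modulo r. Then for every prime number ℓ there exist a unit t ∈ ℤ_ℓ^× and elements x, y, z ∈ ℤ_ℓ, not all three divisible by ℓ, such that t·z² = a·x² + b·x·y + c·y². -/
/-- An integral binary quadratic form which is primitive at `ℓ` takes a value prime to `ℓ`. -/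
theorem exists_not_dvd_binary_form {ℓ a b c : ℤ} (h : ¬ (ℓ ∣ a ∧ ℓ ∣ b ∧ ℓ ∣ c)) :
    ∃ x y : ℤ, ¬ ℓ ∣ a * x ^ 2 + b * x * y + c * y ^ 2 := by
  by_contra! H
  have ha : ℓ ∣ a := by simpa using H 1 0
  have hc : ℓ ∣ c := by simpa using H 0 1
  have habc : ℓ ∣ a + b + c := by simpa using H 1 1
  exact h ⟨ha, (dvd_add_right ha).mp ((dvd_add_left hc).mp habc), hc⟩

theorem PadicInt.isUnit_intCast_of_not_dvd {ℓ : ℕ} [Fact ℓ.Prime] {n : ℤ}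
    (hn : ¬ (ℓ : ℤ) ∣ n) : IsUnit (n : ℤ_[ℓ]) := by
  rw [PadicInt.isUnit_iff]
  refine le_antisymm (PadicInt.norm_le_one _) (not_lt.mp fun h => hn ?_)
  exact PadicInt.norm_int_lt_one_iff_dvd n |>.mp h

theorem stmt1 (p q r : ℕ) [Fact p.Prime] [Fact q.Prime] [Fact r.Prime]
    (hp7 : p % 8 = 7) (hq7 : q % 8 = 7) (hr7 : r % 8 = 7)
    (hpq : IsSquare ((p : ZMod q))) (hpr : IsSquare ((p : ZMod r)))
    (hqr : IsSquare ((q : ZMod r)))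
    (a b c : ℤ) (hpos : 0 < a) (hdisc : b ^ 2 - 4 * a * c = -((p : ℤ) * q * r))
    (haq : IsSquare ((a : ZMod q))) (haq0 : (a : ZMod q) ≠ 0)
    (hap : ¬ IsSquare ((a : ZMod p))) (har : ¬ IsSquare ((a : ZMod r)))
    (ℓ : ℕ) [Fact ℓ.Prime] :
    ∃ t : ℤ_[ℓ]ˣ, ∃ x y z : ℤ_[ℓ],
      ¬ ((ℓ : ℤ_[ℓ]) ∣ x ∧ (ℓ : ℤ_[ℓ]) ∣ y ∧ (ℓ : ℤ_[ℓ]) ∣ z) ∧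
      (t : ℤ_[ℓ]) * z ^ 2 =
        (a : ℤ_[ℓ]) * x ^ 2 + (b : ℤ_[ℓ]) * x * y + (c : ℤ_[ℓ]) * y ^ 2 := by
  have hℓ : ℓ.Prime := Fact.out
  have hprim : ¬ ((ℓ : ℤ) ∣ a ∧ (ℓ : ℤ) ∣ b ∧ (ℓ : ℤ) ∣ c) := by
    rintro ⟨ha, hb, -⟩
    have ha0 : (a : ZMod ℓ) = 0 := (ZMod.intCast_zmod_eq_zero_iff_dvd a ℓ).mpr ha
    have hdvd : (ℓ : ℤ) ∣ ((p * q * r : ℕ) : ℤ) := by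
      push_cast
      rw [← dvd_neg, ← hdisc]
      exact dvd_sub (dvd_pow hb two_ne_zero) ((ha.mul_left 4).mul_right c)
    rw [Int.natCast_dvd_natCast, hℓ.dvd_mul, hℓ.dvd_mul,
      Nat.prime_dvd_prime_iff_eq hℓ Fact.out, Nat.prime_dvd_prime_iff_eq hℓ Fact.out,
      Nat.prime_dvd_prime_iff_eq hℓ Fact.out] at hdvd
    rcases hdvd with (rfl | rfl) | rfl
    · exact hap (ha0 ▸ IsSquare.zero)
    · exact haq0 ha0
    · exact har (ha0 ▸ IsSquare.zero)
  obtain ⟨x, y, hxy⟩ := exists_not_dvd_binary_form hprim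
  obtain ⟨t, ht⟩ := PadicInt.isUnit_intCast_of_not_dvd hxy
  refine ⟨t, x, y, 1, fun h => PadicInt.prime_p.not_dvd_one h.2.2, ?_⟩
  rw [ht]
  push_cast
  ring
end

section
/- Let p be an odd prime and let u ∈ ℤ_p^× be a p-adic unit whose reduction modulo p is not a square in ℤ/pℤ. Then there do not exist X, Y, z ∈ ℚ_p with z ≠ 0 such that u·X² + u·p·Y² = z². In other words, the diagonal binary quadratic form [u, up] over ℚ_p does not represent any nonzero square. -/
theorem Padic.norm_sq_ne_norm_p_mul_sq {p : ℕ} [Fact p.Prime] {X Y : ℚ_[p]}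
    (h : X ≠ 0 ∨ Y ≠ 0) : ‖X ^ 2‖ ≠ ‖(p : ℚ_[p]) * Y ^ 2‖ := by
  have hp : (p : ℚ_[p]) ≠ 0 := Nat.cast_ne_zero.mpr (Fact.out : p.Prime).ne_zero
  intro hn
  by_cases hX : X = 0
  · simp_all
  by_cases hY : Y = 0
  · simp_all
  rw [Padic.norm_eq_zpow_neg_valuation (pow_ne_zero 2 hX),
    Padic.norm_eq_zpow_neg_valuation (mul_ne_zero hp (pow_ne_zero 2 hY)),
    Padic.valuation_mul hp (pow_ne_zero 2 hY), Padic.valuation_pow, Padic.valuation_pow,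
    Padic.valuation_p] at hn
  have hp1 : (1 : ℝ) < p := by exact_mod_cast (Fact.out : p.Prime).one_lt
  have := zpow_right_injective₀ (by linarith) hp1.ne' hn
  push_cast at this
  omega

theorem Padic.norm_le_one_of_norm_p_mul_sq_le_one {p : ℕ} [Fact p.Prime] {Y : ℚ_[p]}
    (h : ‖(p : ℚ_[p]) * Y ^ 2‖ ≤ 1) : ‖Y‖ ≤ 1 := by
  have hp1 : (1 : ℝ) < p := by exact_mod_cast (Fact.out : p.Prime).one_lt
  have hlt : ‖Y‖ < (p : ℝ) ^ ((0 : ℤ) + 1) := by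
    rw [norm_mul, norm_pow, Padic.norm_p, inv_mul_le_iff₀ (by linarith)] at h
    rw [zero_add, zpow_one]
    nlinarith [norm_nonneg Y]
  simpa using (Padic.norm_le_pow_iff_norm_lt_pow_add_one Y 0).mpr hlt

theorem stmt4 (p : ℕ) [Fact p.Prime] (hp2 : p ≠ 2) (u : ℤ_[p]ˣ)
    (hu : ¬ IsSquare (PadicInt.toZMod ((u : ℤ_[p])))) :
    ¬ ∃ X Y z : ℚ_[p], z ≠ 0 ∧
      ((u : ℤ_[p]) : ℚ_[p]) * X ^ 2 + ((u : ℤ_[p]) : ℚ_[p]) * (p : ℚ_[p]) * Y ^ 2 = z ^ 2 := by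
  rintro ⟨X₀, Y₀, z, hz, h₀⟩
  obtain ⟨X, Y, h⟩ : ∃ X Y : ℚ_[p],
      ((u : ℤ_[p]) : ℚ_[p]) * (X ^ 2 + (p : ℚ_[p]) * Y ^ 2) = 1 := by
    refine ⟨X₀ / z, Y₀ / z, ?_⟩
    field_simp
    linear_combination h₀
  have hXY : X ≠ 0 ∨ Y ≠ 0 := by
    by_contra! hc
    simp [hc.1, hc.2] at h
  have hmax : max ‖X ^ 2‖ ‖(p : ℚ_[p]) * Y ^ 2‖ = 1 := by
    rw [← Padic.add_eq_max_of_ne (Padic.norm_sq_ne_norm_p_mul_sq hXY)]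
    have hnorm := congrArg norm h
    rwa [norm_mul, PadicInt.padic_norm_e_of_padicInt, PadicInt.norm_units, one_mul,
      norm_one] at hnorm
  have hX : ‖X‖ ≤ 1 := by
    have hX2 := (le_max_left _ _).trans hmax.le
    rw [norm_pow] at hX2
    exact (pow_le_one_iff_of_nonneg (norm_nonneg X) two_ne_zero).mp hX2
  have hY : ‖Y‖ ≤ 1 :=
    Padic.norm_le_one_of_norm_p_mul_sq_le_one ((le_max_right _ _).trans hmax.le)
  obtain ⟨X, rfl⟩ : ∃ x : ℤ_[p], (x : ℚ_[p]) = X := ⟨⟨X, hX⟩, rfl⟩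
  obtain ⟨Y, rfl⟩ : ∃ y : ℤ_[p], (y : ℚ_[p]) = Y := ⟨⟨Y, hY⟩, rfl⟩
  have hint : (u : ℤ_[p]) * (X ^ 2 + (p : ℤ_[p]) * Y ^ 2) = 1 := by
    apply Subtype.coe_injective
    push_cast
    exact h
  have hmod := congrArg PadicInt.toZMod hint
  simp only [map_mul, map_add, map_pow, map_natCast, CharP.cast_eq_zero, zero_mul, add_zero,
    map_one] at hmod
  refine hu ⟨(PadicInt.toZMod X)⁻¹, ?_⟩
  rw [eq_inv_of_mul_eq_one_left hmod, sq, mul_inv]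
end

section
/- Let p, q, r be primes congruent to 7 modulo 8 such that p is a quadratic residue modulo q and modulo r, and q is a quadratic residue modulo r. Let f(x,y) = a·x² + b·x·y + c·y² be a positive definite integral binary quadratic form of discriminant b² − 4ac = −p·q·r such that a is a nonzero square modulo q and a quadratic nonresidue modulo p and modulo r. Then there do not exist x, y, z ∈ ℚ_p with z ≠ 0 such that a·x² + b·x·y + c·y² = z²; that is, f does not represent any nonzero square in ℚ_p. -/
/-- In `ℚ_[p]`, an element of odd valuation and a nonzero square have different norms. -/
lemma Padic.norm_p_mul_mul_sq_ne {p : ℕ} [Fact p.Prime] {u t w : ℚ_[p]} (hu : ‖u‖ = 1)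
    (hw : w ≠ 0) : ‖(p : ℚ_[p]) * u * t ^ 2‖ ≠ ‖w ^ 2‖ := by
  intro h
  have hp : (1 : ℝ) < p := by exact_mod_cast (Fact.out : p.Prime).one_lt
  have ht : t ≠ 0 := by
    rintro rfl
    have h0 : ‖w ^ 2‖ = 0 := by simpa using h.symm
    exact hw (by simpa using h0)
  rw [norm_mul, norm_mul, hu, mul_one, Padic.norm_p, norm_pow, norm_pow,
    Padic.norm_eq_zpow_neg_valuation ht, Padic.norm_eq_zpow_neg_valuation hw, ← zpow_natCast,
    ← zpow_natCast, ← zpow_mul, ← zpow_mul, ← zpow_neg_one, ← zpow_add₀ (by positivity)] at h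
  have := zpow_right_injective₀ (by positivity) hp.ne' h
  push_cast at this
  omega

/-- If a `p`-adic unit integer `a` has the form `w² + p u t²` with `u` a `p`-adic unit, then `a`
is a square modulo `p`. -/
lemma Padic.isSquare_zmod_of_sq_add_eq {p : ℕ} [Fact p.Prime] {a : ℤ} {u t w : ℚ_[p]}
    (hu : ‖u‖ = 1) (ha : ‖(a : ℚ_[p])‖ = 1) (h : w ^ 2 + (p : ℚ_[p]) * u * t ^ 2 = a) :
    IsSquare (a : ZMod p) := by
  set s : ℚ_[p] := (p : ℚ_[p]) * u * t ^ 2 with hs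
  have hs1 : ‖s‖ ≠ 1 := by
    have := Padic.norm_p_mul_mul_sq_ne (t := t) hu (one_ne_zero (α := ℚ_[p]))
    rwa [one_pow, norm_one, ← hs] at this
  have hw0 : w ≠ 0 := by
    rintro rfl
    apply hs1
    rw [← ha, ← h]
    simp
  have hmax := Padic.add_eq_max_of_ne (Padic.norm_p_mul_mul_sq_ne (t := t) hu hw0).symm
  rw [← hs, h, ha] at hmax
  have hs2 : ‖s‖ < 1 := lt_of_le_of_ne (hmax ▸ le_max_right _ _) hs1
  have hw1 : ‖w‖ ≤ 1 := by
    have : ‖w ^ 2‖ ≤ 1 := hmax ▸ le_max_left _ _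
    rw [norm_pow] at this
    exact (sq_le_one_iff₀ (norm_nonneg _)).mp this
  let W : ℤ_[p] := ⟨w, hw1⟩
  let S : ℤ_[p] := ⟨s, hs2.le⟩
  have hS : PadicInt.toZMod S = 0 := by
    rw [← RingHom.mem_ker, PadicInt.ker_toZMod, IsLocalRing.mem_maximalIdeal,
      PadicInt.mem_nonunits]
    exact hs2
  have hWS : W ^ 2 + S = (a : ℤ_[p]) := PadicInt.ext h
  have := congrArg PadicInt.toZMod hWS
  rw [map_add, hS, add_zero, map_pow, map_intCast] at this
  exact this ▸ IsSquare.sq _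

theorem stmt5 (p q r : ℕ) [Fact p.Prime] [Fact q.Prime] [Fact r.Prime]
    (hp7 : p % 8 = 7) (hq7 : q % 8 = 7) (hr7 : r % 8 = 7)
    (hpq : IsSquare ((p : ZMod q))) (hpr : IsSquare ((p : ZMod r)))
    (hqr : IsSquare ((q : ZMod r)))
    (a b c : ℤ) (hpos : 0 < a) (hdisc : b ^ 2 - 4 * a * c = -((p : ℤ) * q * r))
    (haq : IsSquare ((a : ZMod q))) (haq0 : (a : ZMod q) ≠ 0)
    (hap : ¬ IsSquare ((a : ZMod p))) (har : ¬ IsSquare ((a : ZMod r))) :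
    ¬ ∃ x y z : ℚ_[p], z ≠ 0 ∧ ((a : ℚ_[p]) * x ^ 2 + (b : ℚ_[p]) * x * y + (c : ℚ_[p]) * y ^ 2) = z ^ 2 := by
  rintro ⟨x, y, z, hz, h⟩
  have hpq' : p ≠ q := by
    rintro rfl
    exact hap haq
  have hpr' : p ≠ r := by
    rintro rfl
    exact (ZMod.exists_sq_eq_prime_iff_of_mod_four_eq_three (by omega) (by omega) hpq').mp hqr hpq
  have hcop : ∀ l : ℕ, l.Prime → p ≠ l → ‖(l : ℚ_[p])‖ = 1 := fun l hl hne =>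
    Padic.norm_natCast_eq_one_iff.mpr ((Nat.coprime_primes Fact.out hl).mpr hne)
  have hu : ‖(q * r : ℚ_[p])‖ = 1 := by
    rw [norm_mul, hcop q Fact.out hpq', hcop r Fact.out hpr', one_mul]
  have ha : ‖(a : ℚ_[p])‖ = 1 := by
    refine le_antisymm (Padic.norm_int_le_one a) (not_lt.mp fun hlt => hap ?_)
    rw [(ZMod.intCast_zmod_eq_zero_iff_dvd a p).mpr (Padic.norm_intCast_lt_one_iff.mp hlt)]
    exact IsSquare.zero
  have hd : (b : ℚ_[p]) ^ 2 - 4 * a * c = -(p * q * r) := by exact_mod_cast hdisc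
  refine hap (Padic.isSquare_zmod_of_sq_add_eq (w := (2 * a * x + b * y) / (2 * z))
    (t := y / (2 * z)) hu ha ?_)
  field_simp
  linear_combination 4 * (a : ℚ_[p]) * h + y ^ 2 * hd
end

section
/- Let p, q, r be primes congruent to 7 modulo 8 such that p is a quadratic residue modulo q and modulo r, and q is a quadratic residue modulo r. Let f(x,y) = a·x² + b·x·y + c·y² be a positive definite integral binary quadratic form of discriminant b² − 4ac = −p·q·r such that a is a nonzero square modulo q and a quadratic nonresidue modulo p and modulo r. Then there do not exist x, y, z ∈ ℚ_r with z ≠ 0 such that a·x² + b·x·y + c·y² = z²; that is, f does not represent any nonzero square in ℚ_r. -/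
/-- Over `ℚ_[r]`, if `d` has odd valuation and the unit `u` is a nonresidue modulo `r`, then
`X ^ 2 + d * Y ^ 2` does not represent `u`. -/
theorem Padic.sq_add_mul_sq_ne_of_not_isSquare {r : ℕ} [Fact r.Prime] {d : ℚ_[r]} (hd0 : d ≠ 0)
    (hd : Odd d.valuation) {u : ℤ} (hu : ¬ IsSquare (u : ZMod r)) (X Y : ℚ_[r]) :
    X ^ 2 + d * Y ^ 2 ≠ u := by
  intro h
  have hu0 : ¬ (r : ℤ) ∣ u := fun hdvd => hu (by
    rw [(ZMod.intCast_zmod_eq_zero_iff_dvd u r).2 hdvd]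
    exact IsSquare.zero)
  have hunorm : ‖(u : ℚ_[r])‖ = 1 :=
    le_antisymm (Padic.norm_int_le_one u)
      (not_lt.1 fun hlt => hu0 (Padic.norm_intCast_lt_one_iff.1 hlt))
  have hodd : Y ≠ 0 → Odd (d * Y ^ 2).valuation := fun hY => by
    rw [Padic.valuation_mul hd0 (pow_ne_zero 2 hY), Padic.valuation_pow]
    exact hd.add_even (by simp)
  have hr : (1 : ℝ) < r := by exact_mod_cast (Fact.out : r.Prime).one_lt
  have hne : Y ≠ 0 → ‖X ^ 2‖ ≠ ‖d * Y ^ 2‖ := by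
    intro hY heq
    have hdY : d * Y ^ 2 ≠ 0 := mul_ne_zero hd0 (pow_ne_zero 2 hY)
    have hX : X ^ 2 ≠ 0 := norm_ne_zero_iff.1 (heq ▸ norm_ne_zero_iff.2 hdY)
    rw [Padic.norm_eq_zpow_neg_valuation hX, Padic.norm_eq_zpow_neg_valuation hdY] at heq
    have hval := zpow_right_injective₀ (by linarith) hr.ne' heq
    have := hodd hY
    rw [← neg_inj.1 hval, Padic.valuation_pow] at this
    exact Int.not_even_iff_odd.2 this (by simp)
  have hlt : ‖d * Y ^ 2‖ < 1 ∧ ‖X ^ 2‖ ≤ 1 := by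
    by_cases hY : Y = 0
    · subst hY
      have hX : X ^ 2 = u := by simpa using h
      simp [hX, Padic.norm_int_le_one]
    · have hmax := Padic.add_eq_max_of_ne (hne hY)
      rw [h, hunorm] at hmax
      refine ⟨lt_of_le_of_ne (hmax ▸ le_max_right _ _) fun h1 => ?_, hmax ▸ le_max_left _ _⟩
      have hdY : d * Y ^ 2 ≠ 0 := mul_ne_zero hd0 (pow_ne_zero 2 hY)
      rw [Padic.norm_eq_zpow_neg_valuation hdY, ← zpow_zero (r : ℝ)] at h1
      have hval := zpow_right_injective₀ (by linarith) hr.ne' h1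
      have := hodd hY
      rw [neg_eq_zero.1 hval] at this
      simp at this
  have hX : ‖X‖ ≤ 1 := by
    rw [norm_pow] at hlt
    exact (sq_le_one_iff₀ (norm_nonneg X)).1 hlt.2
  let w : ℤ_[r] := ⟨X, hX⟩
  have hw : ‖(u : ℤ_[r]) - w ^ 2‖ < 1 := by
    have : (((u : ℤ_[r]) - w ^ 2 : ℤ_[r]) : ℚ_[r]) = d * Y ^ 2 := by
      push_cast
      rw [← h]
      simp [w]
    rw [PadicInt.norm_def, this]
    exact hlt.1
  have hz : PadicInt.toZMod ((u : ℤ_[r]) - w ^ 2) = 0 := by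
    rw [← RingHom.mem_ker, PadicInt.ker_toZMod, IsLocalRing.mem_maximalIdeal,
      PadicInt.mem_nonunits]
    exact hw
  rw [map_sub, map_pow, map_intCast, sub_eq_zero] at hz
  exact hu ⟨PadicInt.toZMod w, by rw [hz, sq]⟩

theorem stmt6 (p q r : ℕ) [Fact p.Prime] [Fact q.Prime] [Fact r.Prime]
    (hp7 : p % 8 = 7) (hq7 : q % 8 = 7) (hr7 : r % 8 = 7)
    (hpq : IsSquare ((p : ZMod q))) (hpr : IsSquare ((p : ZMod r)))
    (hqr : IsSquare ((q : ZMod r)))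
    (a b c : ℤ) (hpos : 0 < a) (hdisc : b ^ 2 - 4 * a * c = -((p : ℤ) * q * r))
    (haq : IsSquare ((a : ZMod q))) (haq0 : (a : ZMod q) ≠ 0)
    (hap : ¬ IsSquare ((a : ZMod p))) (har : ¬ IsSquare ((a : ZMod r))) :
    ¬ ∃ x y z : ℚ_[r], z ≠ 0 ∧ ((a : ℚ_[r]) * x ^ 2 + (b : ℚ_[r]) * x * y + (c : ℚ_[r]) * y ^ 2) = z ^ 2 := by
  rintro ⟨x, y, z, hz, h⟩
  have hp : p.Prime := Fact.out
  have hq : q.Prime := Fact.out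
  have hr : r.Prime := Fact.out
  have hqr_ne : q ≠ r := by
    rintro rfl
    exact har haq
  have hpr_ne : p ≠ r := by
    rintro rfl
    exact (ZMod.exists_sq_eq_prime_iff_of_mod_four_eq_three (by omega) (by omega)
      hqr_ne.symm).1 hqr hpq
  have hval : ((p * q * r : ℕ) : ℚ_[r]).valuation = 1 := by
    rw [Padic.valuation_natCast, padicValNat.mul (mul_ne_zero hp.ne_zero hq.ne_zero) hr.ne_zero,
      padicValNat.mul hp.ne_zero hq.ne_zero, padicValNat_primes hpr_ne.symm,
      padicValNat_primes hqr_ne.symm, padicValNat_self]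
    rfl
  have hd0 : ((p * q * r : ℕ) : ℚ_[r]) ≠ 0 :=
    Nat.cast_ne_zero.2 (mul_ne_zero (mul_ne_zero hp.ne_zero hq.ne_zero) hr.ne_zero)
  have hdisc' : (b : ℚ_[r]) ^ 2 - 4 * a * c = -(p * q * r) := by
    exact_mod_cast congrArg (Int.cast : ℤ → ℚ_[r]) hdisc
  refine Padic.sq_add_mul_sq_ne_of_not_isSquare hd0 (by rw [hval]; exact odd_one) har
    ((2 * a * x + b * y) / (2 * z)) (y / (2 * z)) ?_
  push_cast
  field_simp
  linear_combination 4 * (a : ℚ_[r]) * h + y ^ 2 * hdisc'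
end

section
/- Let p, q, r be primes congruent to 7 modulo 8 such that p is a quadratic residue modulo q and modulo r, and q is a quadratic residue modulo r. Let f(x,y) = a·x² + b·x·y + c·y² be a positive definite integral binary quadratic form of discriminant b² − 4ac = −p·q·r such that a is a nonzero square modulo q and a quadratic nonresidue modulo p and modulo r. Then there exist x, y, z ∈ ℚ_p with z ≠ 0 such that −(a·x² + b·x·y + c·y²) = z²; that is, −f represents a nonzero square in ℚ_p. -/
open Polynomial in
/-- For an odd prime `p`, an integer that is a nonzero square modulo `p` is a square in `ℤ_[p]`. -/
theorem PadicInt.isSquare_intCast_of_isSquare_zmod {p : ℕ} [Fact p.Prime] (hp : p ≠ 2) {n : ℤ}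
    (hn0 : (n : ZMod p) ≠ 0) (hn : IsSquare (n : ZMod p)) : IsSquare (n : ℤ_[p]) := by
  obtain ⟨s, hs⟩ := hn
  obtain ⟨m, rfl⟩ := ZMod.intCast_surjective s
  have hroot : (p : ℤ) ∣ m ^ 2 - n := by
    rw [← ZMod.intCast_zmod_eq_zero_iff_dvd _ p]
    push_cast
    rw [hs]
    ring
  have hderiv : ¬ (p : ℤ) ∣ 2 * m := by
    rw [← ZMod.intCast_zmod_eq_zero_iff_dvd _ p]
    push_cast
    have h2 : (2 : ZMod p) ≠ 0 := Ring.two_ne_zero (by rwa [ZMod.ringChar_zmod_n])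
    have hm : (m : ZMod p) ≠ 0 := fun h ↦ hn0 (by rw [hs, h, mul_zero])
    exact mul_ne_zero h2 hm
  have hnorm_root : ‖((m ^ 2 - n : ℤ) : ℤ_[p])‖ < 1 :=
    PadicInt.norm_int_lt_one_iff_dvd _ |>.2 hroot
  have hnorm_deriv : ‖((2 * m : ℤ) : ℤ_[p])‖ = 1 :=
    le_antisymm (PadicInt.norm_le_one _)
      (not_lt.1 fun h ↦ hderiv (PadicInt.norm_int_lt_one_iff_dvd _ |>.1 h))
  obtain ⟨z, hz, -⟩ := hensels_lemma (p := p) (F := (X ^ 2 - C n : ℤ[X])) (a := (m : ℤ_[p])) (by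
    have h1 : aeval (m : ℤ_[p]) (X ^ 2 - C n : ℤ[X]) = ((m ^ 2 - n : ℤ) : ℤ_[p]) := by simp
    have h2 : aeval (m : ℤ_[p]) (derivative (X ^ 2 - C n : ℤ[X])) = ((2 * m : ℤ) : ℤ_[p]) := by
      simp [map_ofNat (aeval (m : ℤ_[p])) 2]
    rw [h1, h2, hnorm_deriv]
    simpa using hnorm_root)
  refine ⟨z, ?_⟩
  have hz' : z ^ 2 - (n : ℤ_[p]) = 0 := by simpa using hz
  linear_combination -hz'

/-- If `p ≡ 3 (mod 4)`, the negative of a nonresidue modulo `p` is a residue. -/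
theorem ZMod.isSquare_neg_intCast_of_not_isSquare {p : ℕ} [Fact p.Prime] (hp : p % 4 = 3) {a : ℤ}
    (ha : ¬ IsSquare (a : ZMod p)) : IsSquare ((-a : ℤ) : ZMod p) := by
  have ha0 : ((-a : ℤ) : ZMod p) ≠ 0 := fun h ↦ ha (by
    rw [Int.cast_neg, neg_eq_zero] at h
    rw [h]
    exact IsSquare.zero)
  have hneg : ¬ IsSquare ((-1 : ℤ) : ZMod p) := by
    rw [Int.cast_neg, Int.cast_one, ZMod.exists_sq_eq_neg_one_iff]
    exact not_not.2 hp
  rw [← legendreSym.eq_one_iff p ha0, neg_eq_neg_one_mul, legendreSym.mul,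
    (legendreSym.eq_neg_one_iff p).2 hneg, (legendreSym.eq_neg_one_iff p).2 ha]
  norm_num

theorem stmt8 (p q r : ℕ) [Fact p.Prime] [Fact q.Prime] [Fact r.Prime]
    (hp7 : p % 8 = 7) (hq7 : q % 8 = 7) (hr7 : r % 8 = 7)
    (hpq : IsSquare ((p : ZMod q))) (hpr : IsSquare ((p : ZMod r)))
    (hqr : IsSquare ((q : ZMod r)))
    (a b c : ℤ) (hpos : 0 < a) (hdisc : b ^ 2 - 4 * a * c = -((p : ℤ) * q * r))
    (haq : IsSquare ((a : ZMod q))) (haq0 : (a : ZMod q) ≠ 0)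
    (hap : ¬ IsSquare ((a : ZMod p))) (har : ¬ IsSquare ((a : ZMod r))) :
    ∃ x y z : ℚ_[p], z ≠ 0 ∧ -((a : ℚ_[p]) * x ^ 2 + (b : ℚ_[p]) * x * y + (c : ℚ_[p]) * y ^ 2) = z ^ 2 := by
  have ha0 : ((-a : ℤ) : ZMod p) ≠ 0 := fun h ↦ hap (by
    rw [Int.cast_neg, neg_eq_zero] at h
    rw [h]
    exact IsSquare.zero)
  obtain ⟨z, hz⟩ := PadicInt.isSquare_intCast_of_isSquare_zmod (p := p) (by omega) ha0
    (ZMod.isSquare_neg_intCast_of_not_isSquare (by omega) hap)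
  have hz' : -(a : ℚ_[p]) = z * z := by exact_mod_cast congrArg ((↑) : ℤ_[p] → ℚ_[p]) hz
  refine ⟨1, 0, z, ?_, by linear_combination hz'⟩
  intro hz0
  rw [hz0, mul_zero, neg_eq_zero, Int.cast_eq_zero] at hz'
  exact hpos.ne' hz'
end

section
/- Let p, q, r be primes congruent to 7 modulo 8 such that p is a quadratic residue modulo q and modulo r, and q is a quadratic residue modulo r. Let f(x,y) = a·x² + b·x·y + c·y² be a positive definite integral binary quadratic form of discriminant b² − 4ac = −p·q·r such that a is a nonzero square modulo q and a quadratic nonresidue modulo p and modulo r. Then there exist x, y, z ∈ ℚ_r with z ≠ 0 such that −(a·x² + b·x·y + c·y²) = z²; that is, −f represents a nonzero square in ℚ_r. -/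
/-- Hensel's lemma for squares: an integer that is a nonzero square modulo an odd prime `r`
is a square in `ℤ_[r]`. -/
theorem PadicInt.isSquare_intCast_of_isSquare_zmod_s9 {r : ℕ} [Fact r.Prime] (hr : r ≠ 2) {a : ℤ}
    (h0 : (a : ZMod r) ≠ 0) (h : IsSquare (a : ZMod r)) : IsSquare (a : ℤ_[r]) := by
  obtain ⟨s, hs⟩ := h
  obtain ⟨n, rfl⟩ := ZMod.intCast_surjective s
  have hdvd : (r : ℤ) ∣ n ^ 2 - a := by
    rw [← ZMod.intCast_zmod_eq_zero_iff_dvd]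
    push_cast
    rw [hs]
    ring
  have hunit : ¬ (r : ℤ) ∣ 2 * n := by
    rw [← ZMod.intCast_zmod_eq_zero_iff_dvd]
    push_cast
    have hn : (n : ZMod r) ≠ 0 := fun hn => h0 (by rw [hs, hn, zero_mul])
    exact mul_ne_zero (Ring.two_ne_zero (by rwa [ZMod.ringChar_zmod_n])) hn
  have hderiv : ‖((2 * n : ℤ) : ℤ_[r])‖ = 1 :=
    le_antisymm (PadicInt.norm_le_one _)
      (not_lt.mp fun hlt => hunit ((PadicInt.norm_int_lt_one_iff_dvd _).mp hlt))
  have heval : ‖((n ^ 2 - a : ℤ) : ℤ_[r])‖ < 1 := (PadicInt.norm_int_lt_one_iff_dvd _).mpr hdvd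
  push_cast at hderiv heval
  obtain ⟨z, hz, -⟩ := hensels_lemma (F := (Polynomial.X ^ 2 - Polynomial.C a : Polynomial ℤ))
    (a := (n : ℤ_[r])) (by
      simp only [Polynomial.derivative_X_pow, Polynomial.derivative_C,
        map_sub, map_mul, map_pow, Polynomial.aeval_X, Polynomial.aeval_C]
      simpa [hderiv, -norm_mul] using heval)
  exact ⟨z, by simpa [sub_eq_zero, sq, eq_comm] using hz⟩

/-- Modulo a prime `r ≡ 3 (mod 4)`, the negative of a nonsquare is a square. -/
theorem ZMod.isSquare_neg_of_not_isSquare {r : ℕ} [Fact r.Prime] (hr : r % 4 = 3) {a : ℤ}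
    (h : ¬ IsSquare (a : ZMod r)) : IsSquare ((-a : ℤ) : ZMod r) := by
  have h0 : (a : ZMod r) ≠ 0 := fun h0 => h (h0 ▸ IsSquare.zero)
  have h0' : ((-a : ℤ) : ZMod r) ≠ 0 := by simpa using h0
  rw [← legendreSym.eq_one_iff r h0', legendreSym.at_neg (by omega),
    (legendreSym.eq_neg_one_iff r).mpr h, ZMod.χ₄_nat_three_mod_four hr]
  norm_num


theorem stmt9 (p q r : ℕ) [Fact p.Prime] [Fact q.Prime] [Fact r.Prime]
    (hp7 : p % 8 = 7) (hq7 : q % 8 = 7) (hr7 : r % 8 = 7)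
    (hpq : IsSquare ((p : ZMod q))) (hpr : IsSquare ((p : ZMod r)))
    (hqr : IsSquare ((q : ZMod r)))
    (a b c : ℤ) (hpos : 0 < a) (hdisc : b ^ 2 - 4 * a * c = -((p : ℤ) * q * r))
    (haq : IsSquare ((a : ZMod q))) (haq0 : (a : ZMod q) ≠ 0)
    (hap : ¬ IsSquare ((a : ZMod p))) (har : ¬ IsSquare ((a : ZMod r))) :
    ∃ x y z : ℚ_[r], z ≠ 0 ∧ -((a : ℚ_[r]) * x ^ 2 + (b : ℚ_[r]) * x * y + (c : ℚ_[r]) * y ^ 2) = z ^ 2 := by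
  have h0 : ((-a : ℤ) : ZMod r) ≠ 0 := by
    intro h
    rw [Int.cast_neg, neg_eq_zero] at h
    exact har (h ▸ IsSquare.zero)
  obtain ⟨z, hz⟩ := PadicInt.isSquare_intCast_of_isSquare_zmod_s9 (by omega) h0
    (ZMod.isSquare_neg_of_not_isSquare (by omega) har)
  have hz' : -(a : ℚ_[r]) = (z : ℚ_[r]) ^ 2 := by
    have := congrArg (fun w : ℤ_[r] => (w : ℚ_[r])) hz
    push_cast at this
    rw [this, sq]
  refine ⟨1, 0, z, fun hz0 => ?_, by rw [← hz']; ring⟩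
  rw [hz0] at hz'
  have ha : (a : ℚ_[r]) = 0 := by simpa using hz'
  exact hpos.ne' (by exact_mod_cast ha)
end

section
/- Let p, q, r be primes congruent to 7 modulo 8 such that p is a quadratic residue modulo q and modulo r, and q is a quadratic residue modulo r. Let f(x,y) = a·x² + b·x·y + c·y² be a positive definite integral binary quadratic form of discriminant b² − 4ac = −p·q·r such that a is a nonzero square modulo q and a quadratic nonresidue modulo p and modulo r. Then there do not exist x, y, z ∈ ℚ_q with z ≠ 0 such that −(a·x² + b·x·y + c·y²) = z²; that is, −f does not represent any nonzero square in ℚ_q. -/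
/-- Squares of `q`-adic norms are even powers of `q`. -/
theorem Padic.norm_sq_ne_inv_mul_norm_sq {q : ℕ} [Fact q.Prime] {s : ℚ_[q]} (hs : s ≠ 0)
    (w : ℚ_[q]) : ‖s‖ ^ 2 ≠ (q : ℝ)⁻¹ * ‖w‖ ^ 2 := by
  intro h
  have hq : 1 < (q : ℝ) := by exact_mod_cast (Fact.out : q.Prime).one_lt
  have hw : w ≠ 0 := by
    rintro rfl
    simp [hs] at h
  rw [Padic.norm_eq_zpow_neg_valuation hs, Padic.norm_eq_zpow_neg_valuation hw,
    ← zpow_natCast, ← zpow_natCast, ← zpow_mul, ← zpow_mul, ← zpow_neg_one,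
    ← zpow_add₀ (by positivity)] at h
  have := zpow_right_injective₀ (by positivity) hq.ne' h
  push_cast at this
  omega

/-- If `-a` is a nonresidue modulo `q`, the form `X² + a` takes on `ℚ_q` only values whose norm is
the norm of a nonzero square. -/
theorem Padic.exists_norm_sq_add_intCast_eq_norm_sq {q : ℕ} [Fact q.Prime] {a : ℤ}
    (ha : ¬ IsSquare (-(a : ZMod q))) (t : ℚ_[q]) :
    ∃ s : ℚ_[q], s ≠ 0 ∧ ‖t ^ 2 + a‖ = ‖s‖ ^ 2 := by
  rcases le_or_gt ‖t‖ 1 with ht | ht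
  · refine ⟨1, one_ne_zero, ?_⟩
    obtain ⟨t, rfl⟩ : ∃ u : ℤ_[q], (u : ℚ_[q]) = t := ⟨⟨t, ht⟩, rfl⟩
    have hu : ‖t ^ 2 + (a : ℤ_[q])‖ = 1 := by
      by_contra hne
      have hmem : t ^ 2 + (a : ℤ_[q]) ∈ RingHom.ker (PadicInt.toZMod (p := q)) := by
        rw [PadicInt.ker_toZMod, IsLocalRing.mem_maximalIdeal, PadicInt.mem_nonunits]
        exact lt_of_le_of_ne (PadicInt.norm_le_one _) hne
      rw [RingHom.mem_ker, map_add, map_pow, map_intCast] at hmem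
      exact ha ⟨PadicInt.toZMod t, by linear_combination -hmem⟩
    rw [PadicInt.norm_def] at hu
    simpa using hu
  · refine ⟨t, norm_pos_iff.mp (one_pos.trans ht), ?_⟩
    have hlt : ‖(a : ℚ_[q])‖ < ‖t ^ 2‖ := by
      rw [norm_pow]
      exact (Padic.norm_int_le_one a).trans_lt (one_lt_pow₀ ht two_ne_zero)
    rw [Padic.add_eq_max_of_ne hlt.ne', max_eq_left hlt.le, norm_pow]

theorem stmt10 (p q r : ℕ) [Fact p.Prime] [Fact q.Prime] [Fact r.Prime]
    (hp7 : p % 8 = 7) (hq7 : q % 8 = 7) (hr7 : r % 8 = 7)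
    (hpq : IsSquare ((p : ZMod q))) (hpr : IsSquare ((p : ZMod r)))
    (hqr : IsSquare ((q : ZMod r)))
    (a b c : ℤ) (hpos : 0 < a) (hdisc : b ^ 2 - 4 * a * c = -((p : ℤ) * q * r))
    (haq : IsSquare ((a : ZMod q))) (haq0 : (a : ZMod q) ≠ 0)
    (hap : ¬ IsSquare ((a : ZMod p))) (har : ¬ IsSquare ((a : ZMod r))) :
    ¬ ∃ x y z : ℚ_[q], z ≠ 0 ∧ -((a : ℚ_[q]) * x ^ 2 + (b : ℚ_[q]) * x * y + (c : ℚ_[q]) * y ^ 2) = z ^ 2 := by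
  rintro ⟨x, y, z, hz, h⟩
  have hpq_ne : q ≠ p := by rintro rfl; exact hap haq
  have hrq_ne : q ≠ r := by rintro rfl; exact har haq
  have hneg : ¬ IsSquare (-(a : ZMod q)) := by
    intro hna
    have h1 : IsSquare (-1 : ZMod q) := by
      have := hna.div haq
      rwa [neg_div, div_self haq0] at this
    exact ZMod.exists_sq_eq_neg_one_iff.mp h1 (by omega)
  obtain ⟨s, hs, hnorm⟩ :=
    Padic.exists_norm_sq_add_intCast_eq_norm_sq hneg ((2 * a * x + b * y) / (2 * z))
  have hdisc' : (b : ℚ_[q]) ^ 2 - 4 * a * c = -((p : ℚ_[q]) * q * r) := by exact_mod_cast hdisc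
  have key : ((2 * a * x + b * y) / (2 * z)) ^ 2 + (a : ℚ_[q])
      = -((p : ℚ_[q]) * q * r) * (y / (2 * z)) ^ 2 := by
    field_simp
    linear_combination y ^ 2 * hdisc' - 4 * (a : ℚ_[q]) * h
  have norm_prime {l : ℕ} (hl : l.Prime) (hne : q ≠ l) : ‖(l : ℚ_[q])‖ = 1 :=
    Padic.norm_natCast_eq_one_iff.mpr ((Nat.coprime_primes Fact.out hl).mpr hne)
  rw [key, norm_mul, norm_neg, norm_mul, norm_mul, norm_pow, norm_prime Fact.out hpq_ne,
    norm_prime Fact.out hrq_ne, Padic.norm_p, one_mul, mul_one] at hnorm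
  exact Padic.norm_sq_ne_inv_mul_norm_sq hs _ hnorm.symm
end

section
/- Let p, q, r be primes congruent to 7 modulo 8 such that p is a quadratic residue modulo q and modulo r, and q is a quadratic residue modulo r. Let f(x,y) = a·x² + b·x·y + c·y² be a positive definite integral binary quadratic form of discriminant b² − 4ac = −p·q·r such that a is a nonzero square modulo q and a quadratic nonresidue modulo p and modulo r. Then there do not exist x, y, z ∈ ℚ_p with z ≠ 0 such that p·(a·x² + b·x·y + c·y²) = z²; that is, p·f does not represent any nonzero square in ℚ_p. -/
theorem ZMod.isSquare_mul_of_not_isSquare {p : ℕ} [Fact p.Prime] {m n : ℤ}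
    (hm : ¬ IsSquare (m : ZMod p)) (hn : ¬ IsSquare (n : ZMod p)) :
    IsSquare ((m : ZMod p) * n) := by
  have hm0 : (m : ZMod p) ≠ 0 := fun h => hm (h ▸ IsSquare.zero)
  have hn0 : (n : ZMod p) ≠ 0 := fun h => hn (h ▸ IsSquare.zero)
  have hmn : ((m * n : ℤ) : ZMod p) ≠ 0 := by
    push_cast
    exact mul_ne_zero hm0 hn0
  have h : legendreSym p (m * n) = 1 := by
    rw [legendreSym.mul, (legendreSym.eq_neg_one_iff p).2 hm, (legendreSym.eq_neg_one_iff p).2 hn]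
    norm_num
  simpa using (legendreSym.eq_one_iff p hmn).1 h

theorem Padic.norm_prime_mul_sq_ne_norm_sq {p : ℕ} [Fact p.Prime] {w t : ℚ_[p]} (ht : t ≠ 0) :
    ‖(p : ℚ_[p]) * w ^ 2‖ ≠ ‖t ^ 2‖ := by
  intro h
  have hp : (p : ℚ_[p]) ≠ 0 := Nat.cast_ne_zero.2 (Fact.out : p.Prime).ne_zero
  have hw : w ≠ 0 := by
    rintro rfl
    simp at h
    exact ht (by simpa using h.symm)
  have hval : ((p : ℚ_[p]) * w ^ 2).valuation = (t ^ 2).valuation := by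
    have hp1 : (1 : ℝ) < p := by exact_mod_cast (Fact.out : p.Prime).one_lt
    rw [Padic.norm_eq_zpow_neg_valuation (mul_ne_zero hp (pow_ne_zero 2 hw)),
      Padic.norm_eq_zpow_neg_valuation (pow_ne_zero 2 ht)] at h
    have := zpow_right_injective₀ (by linarith) hp1.ne' h
    linarith
  rw [Padic.valuation_mul hp (pow_ne_zero 2 hw), Padic.valuation_pow, Padic.valuation_pow,
    Padic.valuation_p] at hval
  omega

theorem Padic.norm_le_one_of_norm_prime_mul_sq_le_one {p : ℕ} [Fact p.Prime] {w : ℚ_[p]}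
    (h : ‖(p : ℚ_[p]) * w ^ 2‖ ≤ 1) : ‖w‖ ≤ 1 := by
  have hp : (p : ℚ_[p]) ≠ 0 := Nat.cast_ne_zero.2 (Fact.out : p.Prime).ne_zero
  rcases eq_or_ne w 0 with rfl | hw
  · simp
  rw [Padic.norm_le_one_iff_val_nonneg, Padic.valuation_mul hp (pow_ne_zero 2 hw),
    Padic.valuation_pow, Padic.valuation_p] at h
  rw [Padic.norm_le_one_iff_val_nonneg]
  omega

/-- If `n` is a unit square and `a` a nonsquare modulo `p`, the form `[p, n]` does not represent
`a` over the `p`-adic numbers. -/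
theorem Padic.prime_mul_sq_add_mul_sq_ne {p : ℕ} [Fact p.Prime] {n a : ℤ}
    (hn0 : ‖(n : ℚ_[p])‖ = 1) (hn : IsSquare (n : ZMod p)) (ha : ¬ IsSquare (a : ZMod p))
    (w t : ℚ_[p]) : (p : ℚ_[p]) * w ^ 2 + n * t ^ 2 ≠ a := by
  intro h
  have ha1 : ‖(a : ℚ_[p])‖ ≤ 1 := Padic.norm_int_le_one a
  have hnt : ‖(n : ℚ_[p]) * t ^ 2‖ = ‖t ^ 2‖ := by rw [norm_mul, hn0, one_mul]
  rcases le_or_gt ‖t‖ 1 with ht | ht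
  · have hw : ‖w‖ ≤ 1 := by
      apply Padic.norm_le_one_of_norm_prime_mul_sq_le_one
      rw [eq_sub_of_add_eq h, sub_eq_add_neg]
      refine (Padic.nonarchimedean _ _).trans (max_le ha1 ?_)
      rw [norm_neg, hnt, norm_pow]
      exact pow_le_one₀ (norm_nonneg t) ht
    obtain ⟨t, rfl⟩ : ∃ t' : ℤ_[p], (t' : ℚ_[p]) = t := ⟨⟨t, ht⟩, rfl⟩
    obtain ⟨w, rfl⟩ : ∃ w' : ℤ_[p], (w' : ℚ_[p]) = w := ⟨⟨w, hw⟩, rfl⟩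
    have hZ : (p : ℤ_[p]) * w ^ 2 + n * t ^ 2 = a :=
      PadicInt.ext (by exact_mod_cast h)
    have hmod := congrArg (PadicInt.toZMod (p := p)) hZ
    simp only [map_add, map_mul, map_pow, map_natCast, map_intCast, CharP.cast_eq_zero, zero_mul,
      zero_add] at hmod
    exact ha (hmod ▸ hn.mul (IsSquare.sq _))
  · have ht0 : t ≠ 0 := by
      rintro rfl
      norm_num at ht
    apply Padic.norm_prime_mul_sq_ne_norm_sq (w := w) ht0
    have hlt : ‖(a : ℚ_[p])‖ < ‖-((n : ℚ_[p]) * t ^ 2)‖ := by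
      rw [norm_neg, hnt, norm_pow]
      exact ha1.trans_lt (one_lt_pow₀ ht two_ne_zero)
    rw [eq_sub_of_add_eq h, sub_eq_add_neg, Padic.add_eq_max_of_ne hlt.ne, max_eq_right hlt.le,
      norm_neg, hnt]

theorem stmt11 (p q r : ℕ) [Fact p.Prime] [Fact q.Prime] [Fact r.Prime]
    (hp7 : p % 8 = 7) (hq7 : q % 8 = 7) (hr7 : r % 8 = 7)
    (hpq : IsSquare ((p : ZMod q))) (hpr : IsSquare ((p : ZMod r)))
    (hqr : IsSquare ((q : ZMod r)))
    (a b c : ℤ) (hpos : 0 < a) (hdisc : b ^ 2 - 4 * a * c = -((p : ℤ) * q * r))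
    (haq : IsSquare ((a : ZMod q))) (haq0 : (a : ZMod q) ≠ 0)
    (hap : ¬ IsSquare ((a : ZMod p))) (har : ¬ IsSquare ((a : ZMod r))) :
    ¬ ∃ x y z : ℚ_[p], z ≠ 0 ∧ (p : ℚ_[p]) * ((a : ℚ_[p]) * x ^ 2 + (b : ℚ_[p]) * x * y + (c : ℚ_[p]) * y ^ 2) = z ^ 2 := by
  rintro ⟨x, y, z, hz, h⟩
  have hpq_ne : p ≠ q := by
    rintro rfl
    exact hap haq
  have hqp : ¬ IsSquare (q : ZMod p) := fun hq =>
    (ZMod.exists_sq_eq_prime_iff_of_mod_four_eq_three (by omega) (by omega) hpq_ne).1 hq hpq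
  have hpr_ne : p ≠ r := by
    rintro rfl
    exact hqp hqr
  have hrp : ¬ IsSquare (r : ZMod p) := fun hr =>
    (ZMod.exists_sq_eq_prime_iff_of_mod_four_eq_three (by omega) (by omega) hpr_ne).1 hr hpr
  have hsq : IsSquare (((q * r : ℤ)) : ZMod p) := by
    have := ZMod.isSquare_mul_of_not_isSquare (p := p) (m := q) (n := r) (by simpa using hqp)
      (by simpa using hrp)
    simpa using this
  have hnorm : ‖(((q * r : ℤ)) : ℚ_[p])‖ = 1 := by
    have hq : ‖(q : ℚ_[p])‖ = 1 := Padic.norm_natCast_eq_one_iff.2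
      ((Nat.coprime_primes Fact.out Fact.out).2 hpq_ne)
    have hr : ‖(r : ℚ_[p])‖ = 1 := Padic.norm_natCast_eq_one_iff.2
      ((Nat.coprime_primes Fact.out Fact.out).2 hpr_ne)
    push_cast
    rw [norm_mul, hq, hr, one_mul]
  have hd : (b : ℚ_[p]) ^ 2 - 4 * a * c = -((p : ℚ_[p]) * q * r) := by
    exact_mod_cast congrArg (Int.cast : ℤ → ℚ_[p]) hdisc
  apply Padic.prime_mul_sq_add_mul_sq_ne hnorm hsq hap ((2 * a * x + b * y) / (2 * z))
    (p * y / (2 * z))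
  push_cast
  field_simp
  linear_combination (4 * a : ℚ_[p]) * h + p * y ^ 2 * hd
end

section
/- Let p, q, r be primes congruent to 7 modulo 8 such that p is a quadratic residue modulo q and modulo r, and q is a quadratic residue modulo r. Let f(x,y) = a·x² + b·x·y + c·y² be a positive definite integral binary quadratic form of discriminant b² − 4ac = −p·q·r such that a is a nonzero square modulo q and a quadratic nonresidue modulo p and modulo r. Then there do not exist x, y, z ∈ ℚ_r with z ≠ 0 such that q·(a·x² + b·x·y + c·y²) = z²; that is, q·f does not represent any nonzero square in ℚ_r. -/
/-- If `u * X ^ 2 + r * v * Y ^ 2 = n` over `ℚ_[r]` with `u`, `v`, `n` integers and `u`, `v`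
prime to `r`, then `u * s ^ 2 = n` is solvable modulo `r`. -/
theorem exists_zmod_sq_of_padic_eq {r : ℕ} [Fact r.Prime] {u v n : ℤ}
    (hu : (u : ZMod r) ≠ 0) (hv : (v : ZMod r) ≠ 0) {X Y : ℚ_[r]}
    (h : (u : ℚ_[r]) * X ^ 2 + r * v * Y ^ 2 = n) :
    ∃ s : ZMod r, (u : ZMod r) * s ^ 2 = n := by
  have hr : r.Prime := Fact.out
  have norm_one : ∀ m : ℤ, (m : ZMod r) ≠ 0 → ‖(m : ℚ_[r])‖ = 1 := fun m hm =>
    le_antisymm (Padic.norm_int_le_one m) <| not_lt.1 fun hlt =>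
      hm ((ZMod.intCast_zmod_eq_zero_iff_dvd m r).2 (Padic.norm_intCast_lt_one_iff.1 hlt))
  have hu1 := norm_one u hu
  have hv1 := norm_one v hv
  have hn1 : ‖(n : ℚ_[r])‖ ≤ 1 := Padic.norm_int_le_one n
  have hr1 : (1 : ℝ) < r := by exact_mod_cast hr.one_lt
  have normX : ‖(u : ℚ_[r]) * X ^ 2‖ = ‖X‖ ^ 2 := by simp [hu1]
  have normY : ‖(r : ℚ_[r]) * v * Y ^ 2‖ = (r : ℝ)⁻¹ * ‖Y‖ ^ 2 := by simp [hv1]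
  have hne : Y ≠ 0 → ‖X‖ ^ 2 ≠ (r : ℝ)⁻¹ * ‖Y‖ ^ 2 := by
    intro hY heq
    have hX : X ≠ 0 := by
      rintro rfl
      simp [hr.ne_zero, hY] at heq
    rw [Padic.norm_eq_zpow_neg_valuation hX, Padic.norm_eq_zpow_neg_valuation hY,
      ← zpow_natCast, ← zpow_natCast, ← zpow_mul, ← zpow_mul, ← zpow_neg_one,
      ← zpow_add₀ (by positivity)] at heq
    have := zpow_right_injective₀ (by positivity) hr1.ne' heq
    push_cast at this
    omega
  have hmax : max (‖X‖ ^ 2) ((r : ℝ)⁻¹ * ‖Y‖ ^ 2) ≤ 1 := by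
    rcases eq_or_ne Y 0 with rfl | hY
    · have hX2 : (u : ℚ_[r]) * X ^ 2 = n := by simpa using h
      simpa [← normX, hX2] using hn1
    · rw [← normX, ← normY, ← IsUltrametricDist.norm_add_eq_max_of_norm_ne_norm
        (by rw [normX, normY]; exact hne hY), h]
      exact hn1
  have hX1 : ‖X‖ ≤ 1 :=
    (sq_le_one_iff₀ (norm_nonneg _)).1 ((le_max_left _ _).trans hmax)
  have hY1 : ‖Y‖ ≤ 1 := by
    rcases eq_or_ne Y 0 with rfl | hY
    · simp
    have hle := (le_max_right _ _).trans hmax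
    rw [inv_mul_le_iff₀ (by positivity), mul_one, Padic.norm_eq_zpow_neg_valuation hY,
      ← zpow_natCast, ← zpow_mul] at hle
    have hle' := (zpow_le_zpow_iff_right₀ hr1).1 (hle.trans_eq (zpow_one (r : ℝ)).symm)
    rw [Padic.norm_eq_zpow_neg_valuation hY]
    apply zpow_le_one_of_nonpos₀ hr1.le
    push_cast at hle'
    omega
  obtain ⟨X, rfl⟩ : ∃ X' : ℤ_[r], (X' : ℚ_[r]) = X := ⟨⟨X, hX1⟩, rfl⟩
  obtain ⟨Y, rfl⟩ : ∃ Y' : ℤ_[r], (Y' : ℚ_[r]) = Y := ⟨⟨Y, hY1⟩, rfl⟩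
  have hint : (u : ℤ_[r]) * X ^ 2 + r * v * Y ^ 2 = n :=
    Subtype.ext (by push_cast; exact h)
  refine ⟨PadicInt.toZMod X, ?_⟩
  simpa using congrArg PadicInt.toZMod hint

theorem natCast_zmod_ne_zero_of_ne {m n : ℕ} [Fact m.Prime] [Fact n.Prime] (h : m ≠ n) :
    (m : ZMod n) ≠ 0 := fun h0 =>
  h ((Nat.prime_dvd_prime_iff_eq Fact.out Fact.out).1 ((ZMod.natCast_eq_zero_iff m n).1 h0)).symm

theorem stmt12 (p q r : ℕ) [Fact p.Prime] [Fact q.Prime] [Fact r.Prime]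
    (hp7 : p % 8 = 7) (hq7 : q % 8 = 7) (hr7 : r % 8 = 7)
    (hpq : IsSquare ((p : ZMod q))) (hpr : IsSquare ((p : ZMod r)))
    (hqr : IsSquare ((q : ZMod r)))
    (a b c : ℤ) (hpos : 0 < a) (hdisc : b ^ 2 - 4 * a * c = -((p : ℤ) * q * r))
    (haq : IsSquare ((a : ZMod q))) (haq0 : (a : ZMod q) ≠ 0)
    (hap : ¬ IsSquare ((a : ZMod p))) (har : ¬ IsSquare ((a : ZMod r))) :
    ¬ ∃ x y z : ℚ_[r], z ≠ 0 ∧ (q : ℚ_[r]) * ((a : ℚ_[r]) * x ^ 2 + (b : ℚ_[r]) * x * y + (c : ℚ_[r]) * y ^ 2) = z ^ 2 := by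
  have hqr_ne : q ≠ r := by rintro rfl; exact har haq
  have hpr_ne : p ≠ r := by
    rintro rfl
    exact (ZMod.exists_sq_eq_prime_iff_of_mod_four_eq_three (by omega) (by omega) hqr_ne.symm).1
      hqr hpq
  rintro ⟨x, y, z, hz, h⟩
  have hq0 : (q : ZMod r) ≠ 0 := natCast_zmod_ne_zero_of_ne hqr_ne
  have hp0 : (p : ZMod r) ≠ 0 := natCast_zmod_ne_zero_of_ne hpr_ne
  have h2 : (2 : ZMod r) ≠ 0 := by
    have : Fact (Nat.Prime 2) := ⟨Nat.prime_two⟩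
    exact_mod_cast natCast_zmod_ne_zero_of_ne (m := 2) (n := r) (by omega)
  have hD : (b : ℚ_[r]) ^ 2 - 4 * a * c = -(p * q * r) := by
    exact_mod_cast congrArg (Int.cast : ℤ → ℚ_[r]) hdisc
  obtain ⟨s, hs⟩ := exists_zmod_sq_of_padic_eq (r := r) (u := q) (v := p) (n := 4 * a)
    (X := (2 * a * x + b * y) / z) (Y := q * y / z)
    (by exact_mod_cast hq0) (by exact_mod_cast hp0) (by
      push_cast
      field_simp
      linear_combination 4 * (a : ℚ_[r]) * h + (q : ℚ_[r]) * y ^ 2 * hD)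
  obtain ⟨t, ht⟩ := hqr
  push_cast at hs
  refine har ⟨t * s / 2, ?_⟩
  field_simp
  linear_combination -hs + s ^ 2 * ht
end

section
/- Let p, q, r be primes congruent to 7 modulo 8 such that p is a quadratic residue modulo q and modulo r, and q is a quadratic residue modulo r. Let f(x,y) = a·x² + b·x·y + c·y² be a positive definite integral binary quadratic form of discriminant b² − 4ac = −p·q·r such that a is a nonzero square modulo q and a quadratic nonresidue modulo p and modulo r. Then there do not exist x, y, z ∈ ℚ_q with z ≠ 0 such that r·(a·x² + b·x·y + c·y²) = z²; that is, r·f does not represent any nonzero square in ℚ_q. -/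
namespace Padic

variable {p : ℕ} [Fact p.Prime]

/-- The norm form of the unramified quadratic extension: if `d` is a nonresidue modulo `p`, then
`x ^ 2 - d * y ^ 2` has no cancellation. -/
theorem norm_sq_sub_mul_sq {d : ℤ} (hd : ¬ IsSquare (d : ZMod p)) (x y : ℚ_[p]) :
    ‖x ^ 2 - d * y ^ 2‖ = max ‖x‖ ‖y‖ ^ 2 := by
  rcases le_or_gt ‖x‖ ‖y‖ with h | h
  · rw [max_eq_right h]
    rcases eq_or_ne y 0 with rfl | hy
    · obtain rfl : x = 0 := by simpa using h
      simp
    have ht : ‖x / y‖ ≤ 1 := by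
      rw [norm_div]
      exact div_le_one_of_le₀ h (norm_nonneg y)
    obtain ⟨t, htxy⟩ : ∃ t : ℤ_[p], (t : ℚ_[p]) = x / y := ⟨⟨x / y, ht⟩, rfl⟩
    have hunit : ‖t ^ 2 - (d : ℤ_[p])‖ = 1 := by
      rw [← PadicInt.isUnit_iff]
      by_contra hn
      have hmem : t ^ 2 - (d : ℤ_[p]) ∈ RingHom.ker (PadicInt.toZMod (p := p)) := by
        rw [PadicInt.ker_toZMod]
        exact (IsLocalRing.mem_maximalIdeal _).2 hn
      rw [RingHom.mem_ker, map_sub, map_pow, map_intCast, sub_eq_zero] at hmem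
      exact hd ⟨_, by rw [← hmem, sq]⟩
    have hx : x = t * y := by rw [htxy, div_mul_cancel₀ _ hy]
    have hfac : x ^ 2 - d * y ^ 2 = ((t ^ 2 - (d : ℤ_[p]) : ℤ_[p]) : ℚ_[p]) * y ^ 2 := by
      rw [hx]
      push_cast
      ring
    rw [hfac, norm_mul, PadicInt.padic_norm_e_of_padicInt, hunit, one_mul, norm_pow]
  · have hlt : ‖-((d : ℚ_[p]) * y ^ 2)‖ < ‖x ^ 2‖ := by
      rw [norm_neg, norm_mul, norm_pow, norm_pow]
      calc ‖(d : ℚ_[p])‖ * ‖y‖ ^ 2 ≤ 1 * ‖y‖ ^ 2 := by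
            gcongr
            exact Padic.norm_int_le_one d
        _ < ‖x‖ ^ 2 := by
            rw [one_mul]
            gcongr
    rw [max_eq_left h.le, sub_eq_add_neg, Padic.add_eq_max_of_ne hlt.ne', max_eq_left hlt.le,
      norm_pow]

theorem norm_natCast_self_mul_sq_ne_sq {x : ℚ_[p]} (hx : x ≠ 0) (y : ℚ_[p]) :
    ‖(p : ℚ_[p])‖ * ‖y‖ ^ 2 ≠ ‖x‖ ^ 2 := by
  intro h
  rcases eq_or_ne y 0 with rfl | hy
  · exact hx (by simpa using h.symm)
  have hp : (p : ℚ_[p]) ≠ 0 := Nat.cast_ne_zero.2 (Fact.out : p.Prime).ne_zero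
  rw [← norm_pow, ← norm_pow, ← norm_mul,
    Padic.norm_eq_zpow_neg_valuation (mul_ne_zero hp (pow_ne_zero 2 hy)),
    Padic.norm_eq_zpow_neg_valuation (pow_ne_zero 2 hx)] at h
  have hp1 : (1 : ℝ) < p := by exact_mod_cast (Fact.out : p.Prime).one_lt
  have hval := zpow_right_injective₀ (zero_lt_one.trans hp1) hp1.ne' h
  rw [Padic.valuation_mul hp (pow_ne_zero 2 hy), Padic.valuation_p, Padic.valuation_pow,
    Padic.valuation_pow] at hval
  push_cast at hval
  omega

end Padic

theorem stmt13 (p q r : ℕ) [Fact p.Prime] [Fact q.Prime] [Fact r.Prime]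
    (hp7 : p % 8 = 7) (hq7 : q % 8 = 7) (hr7 : r % 8 = 7)
    (hpq : IsSquare ((p : ZMod q))) (hpr : IsSquare ((p : ZMod r)))
    (hqr : IsSquare ((q : ZMod r)))
    (a b c : ℤ) (hpos : 0 < a) (hdisc : b ^ 2 - 4 * a * c = -((p : ℤ) * q * r))
    (haq : IsSquare ((a : ZMod q))) (haq0 : (a : ZMod q) ≠ 0)
    (hap : ¬ IsSquare ((a : ZMod p))) (har : ¬ IsSquare ((a : ZMod r))) :
    ¬ ∃ x y z : ℚ_[q], z ≠ 0 ∧ (r : ℚ_[q]) * ((a : ℚ_[q]) * x ^ 2 + (b : ℚ_[q]) * x * y + (c : ℚ_[q]) * y ^ 2) = z ^ 2 := by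
  rintro ⟨x, y, z, hz, h⟩
  have hqp_ne : q ≠ p := by
    rintro rfl
    exact hap haq
  have hqr_ne : q ≠ r := by
    rintro rfl
    exact har haq
  have hr_nonres : ¬ IsSquare (r : ZMod q) :=
    (ZMod.exists_sq_eq_prime_iff_of_mod_four_eq_three (p := r) (q := q) (by omega) (by omega)
      hqr_ne.symm).1 hqr
  have had : ¬ IsSquare (((a * r : ℤ)) : ZMod q) := by
    intro hs
    refine hr_nonres ?_
    have : (r : ZMod q) = ((a * r : ℤ) : ZMod q) / (a : ZMod q) := by
      push_cast
      field_simp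
    rw [this]
    exact hs.div haq
  have hnorm (l : ℕ) [hl : Fact l.Prime] (hne : q ≠ l) : ‖(l : ℚ_[q])‖ = 1 :=
    Padic.norm_natCast_eq_one_iff.2 ((Nat.coprime_primes Fact.out hl.out).2 hne)
  have hdisc' : (b : ℚ_[q]) ^ 2 - 4 * a * c = -((p : ℚ_[q]) * q * r) := by exact_mod_cast hdisc
  have key : ((r : ℚ_[q]) * (2 * a * x + b * y)) ^ 2 - ((a * r : ℤ) : ℚ_[q]) * (2 * z) ^ 2 =
      -((p : ℚ_[q]) * q * r ^ 3 * y ^ 2) := by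
    push_cast
    linear_combination (r : ℚ_[q]) ^ 2 * y ^ 2 * hdisc' + 4 * (a : ℚ_[q]) * r * h
  have hn := Padic.norm_sq_sub_mul_sq had ((r : ℚ_[q]) * (2 * a * x + b * y)) (2 * z)
  rw [key, norm_neg, norm_mul, norm_mul, norm_mul, norm_pow, norm_pow, hnorm p hqp_ne,
    hnorm r hqr_ne, one_mul, one_pow, mul_one] at hn
  have hz2 : 2 * z ≠ 0 := mul_ne_zero two_ne_zero hz
  rcases le_or_gt ‖(r : ℚ_[q]) * (2 * a * x + b * y)‖ ‖2 * z‖ with hle | hlt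
  · rw [max_eq_right hle] at hn
    exact Padic.norm_natCast_self_mul_sq_ne_sq hz2 y hn
  · rw [max_eq_left hlt.le] at hn
    exact Padic.norm_natCast_self_mul_sq_ne_sq
      (norm_pos_iff.1 ((norm_nonneg _).trans_lt hlt)) y hn
end

section
/- Let p, q, r be primes congruent to 7 modulo 8 such that p is a quadratic residue modulo q and modulo r, and q is a quadratic residue modulo r. Let f(x,y) = a·x² + b·x·y + c·y² be a positive definite integral binary quadratic form of discriminant b² − 4ac = −p·q·r such that a is a nonzero square modulo q and a quadratic nonresidue modulo p and modulo r. Then there do not exist x, y, z ∈ ℚ_p with z ≠ 0 such that p·q·r·(a·x² + b·x·y + c·y²) = z²; that is, pqr·f does not represent any nonzero square in ℚ_p. -/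
/-- The binary form `a - t ^ 2` takes only values of even valuation when `a` is a nonresidue. -/
theorem exists_norm_intCast_sub_sq_eq_norm_sq {p : ℕ} [Fact p.Prime] {a : ℤ}
    (ha : ¬ IsSquare (a : ZMod p)) (t : ℚ_[p]) :
    ∃ w : ℚ_[p], w ≠ 0 ∧ ‖(a : ℚ_[p]) - t ^ 2‖ = ‖w‖ ^ 2 := by
  rcases le_or_gt ‖t‖ 1 with ht | ht
  · refine ⟨1, one_ne_zero, ?_⟩
    obtain ⟨t, rfl⟩ : ∃ s : ℤ_[p], (s : ℚ_[p]) = t := ⟨⟨t, ht⟩, rfl⟩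
    have hunit : ‖(a : ℤ_[p]) - t ^ 2‖ = 1 := by
      refine le_antisymm (PadicInt.norm_le_one _) (not_lt.mp fun hlt => ha ?_)
      have hmem : (a : ℤ_[p]) - t ^ 2 ∈ RingHom.ker (PadicInt.toZMod (p := p)) := by
        rw [PadicInt.ker_toZMod, IsLocalRing.mem_maximalIdeal]
        exact PadicInt.mem_nonunits.mpr hlt
      rw [RingHom.mem_ker, map_sub, map_intCast, map_pow, sub_eq_zero] at hmem
      exact ⟨PadicInt.toZMod t, by rw [hmem, sq]⟩
    rw [PadicInt.norm_def] at hunit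
    push_cast at hunit
    simpa using hunit
  · refine ⟨t, fun h => by simp [h] at ht; linarith, ?_⟩
    have hlt : ‖(a : ℚ_[p])‖ < ‖t ^ 2‖ := by
      rw [norm_pow]
      exact (Padic.norm_int_le_one a).trans_lt (one_lt_pow₀ ht two_ne_zero)
    rw [sub_eq_add_neg, Padic.add_eq_max_of_ne (by rw [norm_neg]; exact hlt.ne), norm_neg,
      max_eq_right hlt.le, norm_pow]

theorem norm_natCast_prime_ne_norm_sq {p : ℕ} [Fact p.Prime] (w : ℚ_[p]) :
    ‖(p : ℚ_[p])‖ ≠ ‖w‖ ^ 2 := by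
  intro h
  have hp : (1 : ℝ) < p := mod_cast (Fact.out : p.Prime).one_lt
  by_cases hw : w = 0
  · simp [hw, (Fact.out : p.Prime).ne_zero] at h
  · rw [Padic.norm_p, Padic.norm_eq_zpow_neg_valuation hw, ← zpow_natCast, ← zpow_mul,
      ← zpow_neg_one] at h
    have := zpow_right_injective₀ (by linarith) hp.ne' h
    push_cast at this
    omega

theorem eq_zero_of_mul_sq_sub_sq_eq_prime_mul_sq {p : ℕ} [Fact p.Prime] {a : ℤ}
    (ha : ¬ IsSquare (a : ZMod p)) {m : ℚ_[p]} (hm : ‖m‖ = 1) {x y z : ℚ_[p]}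
    (h : a * z ^ 2 - y ^ 2 = p * m * x ^ 2) : z = 0 := by
  by_contra hz
  obtain ⟨w, hw0, hw⟩ := exists_norm_intCast_sub_sq_eq_norm_sq ha (y / z)
  have heq : (a : ℚ_[p]) - (y / z) ^ 2 = p * m * (x / z) ^ 2 := by
    field_simp
    linear_combination h
  rw [heq, norm_mul, norm_mul, hm, mul_one, norm_pow] at hw
  have hs : x / z ≠ 0 := by
    intro hs
    rw [hs, norm_zero, zero_pow two_ne_zero, mul_zero] at hw
    exact pow_ne_zero 2 (norm_ne_zero_iff.mpr hw0) hw.symm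
  apply norm_natCast_prime_ne_norm_sq (p := p) (w / (x / z))
  rw [norm_div, div_pow, ← hw, mul_div_cancel_right₀]
  exact pow_ne_zero _ (norm_ne_zero_iff.mpr hs)

theorem stmt14 (p q r : ℕ) [Fact p.Prime] [Fact q.Prime] [Fact r.Prime]
    (hp7 : p % 8 = 7) (hq7 : q % 8 = 7) (hr7 : r % 8 = 7)
    (hpq : IsSquare ((p : ZMod q))) (hpr : IsSquare ((p : ZMod r)))
    (hqr : IsSquare ((q : ZMod r)))
    (a b c : ℤ) (hpos : 0 < a) (hdisc : b ^ 2 - 4 * a * c = -((p : ℤ) * q * r))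
    (haq : IsSquare ((a : ZMod q))) (haq0 : (a : ZMod q) ≠ 0)
    (hap : ¬ IsSquare ((a : ZMod p))) (har : ¬ IsSquare ((a : ZMod r))) :
    ¬ ∃ x y z : ℚ_[p], z ≠ 0 ∧ ((p : ℚ_[p]) * (q : ℚ_[p]) * (r : ℚ_[p])) * ((a : ℚ_[p]) * x ^ 2 + (b : ℚ_[p]) * x * y + (c : ℚ_[p]) * y ^ 2) = z ^ 2 := by
  rintro ⟨x, y, z, hz, h⟩
  have hpq_ne : p ≠ q := by
    rintro rfl
    exact hap haq
  have hpr_ne : p ≠ r := by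
    rintro rfl
    exact (ZMod.exists_sq_eq_prime_iff_of_mod_four_eq_three (by omega) (by omega) hpq_ne).mp
      hqr hpq
  have norm_prime {l : ℕ} (hl : l.Prime) (hne : p ≠ l) : ‖(l : ℚ_[p])‖ = 1 :=
    Padic.norm_natCast_eq_one_iff.mpr ((Nat.coprime_primes Fact.out hl).mpr hne)
  have hm : ‖(q * r : ℚ_[p])‖ = 1 := by
    rw [norm_mul, norm_prime Fact.out hpq_ne, norm_prime Fact.out hpr_ne, mul_one]
  have hd : (b : ℚ_[p]) ^ 2 - 4 * a * c = -(p * q * r) :=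
    mod_cast congrArg (Int.cast (R := ℚ_[p])) hdisc
  have hzero : 2 * z = 0 :=
    eq_zero_of_mul_sq_sub_sq_eq_prime_mul_sq hap hm
      (x := 2 * a * x + b * y) (y := p * q * r * y) (z := 2 * z) (by
        linear_combination (-4 * a : ℚ_[p]) * h - (p * q * r * y ^ 2 : ℚ_[p]) * hd)
  exact hz (by simpa using hzero)
end

section
/- There do not exist rational numbers x, y, z, not all zero, a sign ε ∈ {1, −1}, and a positive squarefree integer s dividing 2·7·31·47, such that 3x² + xy + 850y² = ε·s·z². -/
theorem ZMod.eq_zero_of_sq_eq_three_mul_sq :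
    ∀ a b : ZMod 31, a ^ 2 = 3 * b ^ 2 → a = 0 ∧ b = 0 := by
  decide +kernel

theorem ZMod.exists_sq_eq_of_dvd_658 {t : ℕ} (ht : t ∣ 658) :
    ∃ u : ZMod 31, u ≠ 0 ∧ (t : ZMod 31) = u ^ 2 := by
  have h : ∀ t ∈ Nat.divisors 658, ∃ u : ZMod 31, u ≠ 0 ∧ (t : ZMod 31) = u ^ 2 := by
    decide +kernel
  exact h t (by simp [ht])

/-- `12 t` is a quadratic nonresidue modulo 31 for every divisor `t` of `2 * 7 * 47`. -/
theorem Int.dvd_of_sq_modEq_twelve_mul_sq {t : ℕ} (ht : t ∣ 658) {a c : ℤ}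
    (h : (a : ZMod 31) ^ 2 = 12 * t * (c : ZMod 31) ^ 2) : (31 : ℤ) ∣ a ∧ (31 : ℤ) ∣ c := by
  obtain ⟨u, hu, htu⟩ := ZMod.exists_sq_eq_of_dvd_658 ht
  have h2 : (2 : ZMod 31) ≠ 0 := by decide
  have : Fact (Nat.Prime 31) := ⟨by norm_num⟩
  obtain ⟨ha, hc⟩ := ZMod.eq_zero_of_sq_eq_three_mul_sq a (2 * u * c) (by
    rw [h, htu]; ring)
  have hc' : (c : ZMod 31) = 0 := by simpa [hu, h2] using hc
  exact ⟨(ZMod.intCast_zmod_eq_zero_iff_dvd a 31).1 ha,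
    (ZMod.intCast_zmod_eq_zero_iff_dvd c 31).1 hc'⟩

theorem Int.dvd_of_thirtyOne_mul_sq_add_eq {k m : ℤ} (hm : ¬ (31 : ℤ) ∣ m) {b : ℤ}
    (h : 31 * k = m * b ^ 2) : (31 : ℤ) ∣ b := by
  have hp : Prime (31 : ℤ) := by norm_num
  exact hp.dvd_of_dvd_pow ((hp.dvd_or_dvd (Dvd.intro k h)).resolve_left hm)

/-- Every integral zero of `a² + 10199 b² - 12 s c²` is divisible by 31. -/
theorem Int.dvd_of_sq_add_eq {s : ℕ} (hs : s ∣ 2 * 7 * 31 * 47) {a b c : ℤ}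
    (h : a ^ 2 + 10199 * b ^ 2 = 12 * s * c ^ 2) :
    (31 : ℤ) ∣ a ∧ (31 : ℤ) ∣ b ∧ (31 : ℤ) ∣ c := by
  have h31 : (10199 : ZMod 31) = 0 := by decide
  by_cases h31s : 31 ∣ s
  · obtain ⟨t, rfl⟩ := h31s
    have ht : t ∣ 658 := Nat.dvd_of_mul_dvd_mul_left (k := 31) (by norm_num) hs
    push_cast at h
    obtain ⟨a, rfl⟩ : (31 : ℤ) ∣ a := Int.dvd_of_thirtyOne_mul_sq_add_eq (m := 1)
      (k := 12 * t * c ^ 2 - 329 * b ^ 2) (by norm_num) (by linarith)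
    have h' : 31 * a ^ 2 + 329 * b ^ 2 = 12 * t * c ^ 2 := by linarith
    have hmod := congrArg (Int.cast : ℤ → ZMod 31) h'
    push_cast at hmod
    have h0 : (31 : ZMod 31) = 0 := by decide
    have h329 : (329 : ZMod 31) = 9 ^ 2 := by decide
    rw [h0, h329] at hmod
    obtain ⟨hb9, c, rfl⟩ := Int.dvd_of_sq_modEq_twelve_mul_sq ht (a := 9 * b) (c := c) (by
      push_cast; rw [← hmod]; ring)
    obtain ⟨b, rfl⟩ : (31 : ℤ) ∣ b := by omega
    exact ⟨Dvd.intro _ rfl, Dvd.intro _ rfl, Dvd.intro _ rfl⟩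
  · have ht : s ∣ 658 := by
      have hco : Nat.Coprime s 31 := ((Nat.Prime.coprime_iff_not_dvd (by norm_num)).2 h31s).symm
      exact hco.dvd_of_dvd_mul_right (n := 31) hs
    have hmod := congrArg (Int.cast : ℤ → ZMod 31) h
    push_cast at hmod
    rw [h31, zero_mul, add_zero] at hmod
    obtain ⟨⟨a, rfl⟩, c, rfl⟩ := Int.dvd_of_sq_modEq_twelve_mul_sq ht hmod
    have hb : (31 : ℤ) ∣ b := Int.dvd_of_thirtyOne_mul_sq_add_eq (m := 329)
      (k := 12 * s * c ^ 2 - a ^ 2) (by norm_num) (by linarith)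
    exact ⟨Dvd.intro _ rfl, hb, Dvd.intro _ rfl⟩

theorem Int.pow_dvd_of_sq_add_eq {s : ℕ} (hs : s ∣ 2 * 7 * 31 * 47) (n : ℕ) {a b c : ℤ}
    (h : a ^ 2 + 10199 * b ^ 2 = 12 * s * c ^ 2) :
    (31 : ℤ) ^ n ∣ a ∧ (31 : ℤ) ^ n ∣ b ∧ (31 : ℤ) ^ n ∣ c := by
  induction n generalizing a b c with
  | zero => simp
  | succ n ih =>
    obtain ⟨⟨a, rfl⟩, ⟨b, rfl⟩, c, rfl⟩ := Int.dvd_of_sq_add_eq hs h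
    obtain ⟨ha, hb, hc⟩ := ih (a := a) (b := b) (c := c) (by linarith)
    simp only [pow_succ']
    exact ⟨mul_dvd_mul_left _ ha, mul_dvd_mul_left _ hb, mul_dvd_mul_left _ hc⟩

theorem Int.eq_zero_of_forall_pow_dvd {a : ℤ} (h : ∀ n : ℕ, (31 : ℤ) ^ n ∣ a) : a = 0 := by
  refine Int.eq_zero_of_abs_lt_dvd (h a.natAbs) ?_
  rw [Int.abs_eq_natAbs]
  exact_mod_cast Nat.lt_pow_self (by norm_num : 1 < 31)

theorem Rat.eq_zero_of_sq_add_eq {s : ℕ} (hs : s ∣ 2 * 7 * 31 * 47) {a b c : ℚ}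
    (h : a ^ 2 + 10199 * b ^ 2 = 12 * s * c ^ 2) : a = 0 ∧ b = 0 ∧ c = 0 := by
  have ha := Rat.mul_den_eq_num a
  have hb := Rat.mul_den_eq_num b
  have hc := Rat.mul_den_eq_num c
  have key : (a.num * b.den * c.den) ^ 2 + 10199 * (b.num * a.den * c.den) ^ 2
      = 12 * s * (c.num * a.den * b.den) ^ 2 := by
    have : ((a.num : ℚ) * b.den * c.den) ^ 2 + 10199 * (b.num * a.den * c.den) ^ 2
        = 12 * s * (c.num * a.den * b.den) ^ 2 := by
      rw [← ha, ← hb, ← hc]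
      linear_combination ((a.den : ℚ) * b.den * c.den) ^ 2 * h
    exact_mod_cast this
  have hz := fun n => Int.pow_dvd_of_sq_add_eq hs n key
  have h1 := Int.eq_zero_of_forall_pow_dvd fun n => (hz n).1
  have h2 := Int.eq_zero_of_forall_pow_dvd fun n => (hz n).2.1
  have h3 := Int.eq_zero_of_forall_pow_dvd fun n => (hz n).2.2
  simp only [mul_eq_zero, Nat.cast_eq_zero, Rat.den_ne_zero, or_false, Rat.num_eq_zero]
    at h1 h2 h3
  exact ⟨h1, h2, h3⟩

theorem stmt17 :
    ¬ ∃ (x y z : ℚ) (ε : ℤ) (s : ℕ),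
      (ε = 1 ∨ ε = -1) ∧ 0 < s ∧ Squarefree s ∧ s ∣ 2 * 7 * 31 * 47 ∧
      ¬ (x = 0 ∧ y = 0 ∧ z = 0) ∧
      3 * x ^ 2 + x * y + 850 * y ^ 2 = (ε : ℚ) * (s : ℚ) * z ^ 2 := by
  rintro ⟨x, y, z, ε, s, hε, hs0, -, hs, hne, h⟩
  apply hne
  rcases hε with rfl | rfl
  · obtain ⟨h1, rfl, rfl⟩ := Rat.eq_zero_of_sq_add_eq hs (a := 6 * x + y) (b := y) (c := z) (by
      push_cast at h
      linear_combination 12 * h)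
    exact ⟨by linarith, rfl, rfl⟩
  · have hs0' : (0 : ℚ) < s := by exact_mod_cast hs0
    have hsum : (6 * x + y) ^ 2 + 10199 * y ^ 2 + 12 * (s * z ^ 2) = 0 := by
      push_cast at h
      linear_combination 12 * h
    have hz : 0 ≤ s * z ^ 2 := by positivity
    have hy0 : y = 0 := by
      apply pow_eq_zero_iff (two_ne_zero) |>.1
      nlinarith [sq_nonneg (6 * x + y), sq_nonneg y]
    subst hy0
    have hx0 : x = 0 := by
      apply pow_eq_zero_iff (two_ne_zero) |>.1
      nlinarith [sq_nonneg x]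
    subst hx0
    have hz0 : (s : ℚ) * z ^ 2 = 0 := by linarith
    exact ⟨rfl, rfl, by simpa [hs0'.ne'] using hz0⟩
end

section
/- For every prime number ℓ, there exist a unit t ∈ ℤ_ℓ^× and elements x, y, z ∈ ℤ_ℓ, not all three divisible by ℓ, such that t·z² = 3x² + xy + 850y². -/
theorem PadicInt.isUnit_natCast_of_coprime {p : ℕ} [Fact p.Prime] {n : ℕ} (h : p.Coprime n) :
    IsUnit (n : ℤ_[p]) :=
  PadicInt.isUnit_iff.2 (PadicInt.norm_natCast_eq_one_iff.2 h)

theorem stmt18 (ℓ : ℕ) [Fact ℓ.Prime] :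
    ∃ t : ℤ_[ℓ]ˣ, ∃ x y z : ℤ_[ℓ],
      ¬ ((ℓ : ℤ_[ℓ]) ∣ x ∧ (ℓ : ℤ_[ℓ]) ∣ y ∧ (ℓ : ℤ_[ℓ]) ∣ z) ∧
      (t : ℤ_[ℓ]) * z ^ 2 = 3 * x ^ 2 + x * y + 850 * y ^ 2 := by
  have hℓ : ¬ (ℓ : ℤ_[ℓ]) ∣ 1 := PadicInt.prime_p.not_dvd_one
  by_cases h : ℓ = 3
  · have hcop : ℓ.Coprime 850 := by subst h; norm_num
    obtain ⟨t, ht⟩ := PadicInt.isUnit_natCast_of_coprime hcop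
    exact ⟨t, 0, 1, 1, fun hd => hℓ hd.2.2, by simp [ht]⟩
  · have hcop : ℓ.Coprime 3 := (Nat.coprime_primes Fact.out Nat.prime_three).2 h
    obtain ⟨t, ht⟩ := PadicInt.isUnit_natCast_of_coprime hcop
    exact ⟨t, 1, 0, 1, fun hd => hℓ hd.2.2, by simp [ht]⟩
end
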